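/- arXiv:1612.07562 — 7 statements merged into one kernel-verified Lean document; each statement's English description precedes it below -/
import Mathlib

section
/- Let A be an s×s real matrix with nonnegative entries a_{ij}, let π ∈ ℝ^s be entrywise positive, let λ ∈ ℝ, and let x ∈ ℝ^s be entrywise positive with ∑_i x_i a_{ij} = λ x_j for all j (x is a left eigenvector of A with eigenvalue λ). Define y_i = x_i/π_i for each i, and define the s×s matrix B by b_{ij} = y_i·(∑_{l=1}^s x_l a_{lj}) / (∑_{m=1}^s x_m²/π_m). Then B y = λ y, i.e., ∑_{j=1}^s b_{ij} y_j = λ y_i for every i. -/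
open Finset

/-- Zero-error condition 1: if `x` is a positive left eigenvector of the
nonnegative matrix `A` with eigenvalue `λ`, `π` is entrywise positive,
`y i = x i / π i`, and `B i j = y i * (∑ l, x l * A l j) / (∑ m, x m ^ 2 / π m)`,
then `B y = λ y`. -/
theorem stmt_0 (s : ℕ) (A : Matrix (Fin s) (Fin s) ℝ)
    (hA : ∀ i j, 0 ≤ A i j)
    (π : Fin s → ℝ) (hπ : ∀ i, 0 < π i)
    (lam : ℝ) (x : Fin s → ℝ) (hx : ∀ i, 0 < x i)
    (heig : ∀ j, ∑ i, x i * A i j = lam * x j)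
    (y : Fin s → ℝ) (hy : ∀ i, y i = x i / π i)
    (B : Matrix (Fin s) (Fin s) ℝ)
    (hB : ∀ i j, B i j = y i * (∑ l, x l * A l j) / (∑ m, x m ^ 2 / π m)) :
    ∀ i, ∑ j, B i j * y j = lam * y i := by
  intro i
  have hS : 0 < ∑ m, x m ^ 2 / π m :=
    Finset.sum_pos (fun m _ => div_pos (pow_pos (hx m) 2) (hπ m)) ⟨i, Finset.mem_univ i⟩
  have hterm : ∀ j, B i j * y j =
      lam * y i / (∑ m, x m ^ 2 / π m) * (x j ^ 2 / π j) := fun j => by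
    rw [hB, heig, hy j]
    ring
  rw [Finset.sum_congr rfl fun j _ => hterm j, ← Finset.mul_sum, div_mul_cancel₀ _ hS.ne']
end

section
/- Let s ≥ 1 and let A be an s×s real matrix with strictly positive entries a_{ij}. Assume r > 0 and x, y ∈ ℝ^s are entrywise positive vectors with ∑_i x_i a_{ij} = r x_j for all j, ∑_j a_{ij} y_j = r y_i for all i, and ∑_i x_i y_i = 1. Let β ∈ ℝ^s be entrywise positive, let λ₀ > 0, and define the s×s matrix B by b_{ij} = λ₀ a_{ij} β_i / β_j. If ∏_{i,j=1}^s b_{ij}^{a_{ij} x_i y_j} = ∏_{i,j=1}^s a_{ij}^{a_{ij} x_i y_j}, then λ₀ = 1 and the entrywise positive vector z defined by z_i = β_i y_i satisfies B z = r z; in particular B has r as an eigenvalue. -/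
open Finset

theorem log_prod_prod_rpow {ι κ : Type*} [Fintype ι] [Fintype κ] (M w : ι → κ → ℝ)
    (hM : ∀ i j, 0 < M i j) :
    Real.log (∏ i, ∏ j, M i j ^ w i j) = ∑ i, ∑ j, w i j * Real.log (M i j) := by
  have hpos : ∀ i j, 0 < M i j ^ w i j := fun i j => Real.rpow_pos_of_pos (hM i j) _
  rw [Real.log_prod fun i _ => (prod_pos fun j _ => hpos i j).ne']
  refine sum_congr rfl fun i _ => ?_
  rw [Real.log_prod fun j _ => (hpos i j).ne']
  exact sum_congr rfl fun j _ => Real.log_rpow (hM i j) _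

/-- Weights whose row and column marginals agree annihilate differences `f i - f j`. -/
theorem sum_sum_mul_const_add_sub {ι : Type*} [Fintype ι] (w : ι → ι → ℝ) (m f : ι → ℝ) (c : ℝ)
    (hrow : ∀ i, ∑ j, w i j = m i) (hcol : ∀ j, ∑ i, w i j = m j) :
    ∑ i, ∑ j, w i j * (c + f i - f j) = c * ∑ i, m i := by
  have h₁ : ∑ i, ∑ j, w i j * f i = ∑ i, m i * f i :=
    sum_congr rfl fun i _ => by rw [← sum_mul, hrow]
  have h₂ : ∑ i, ∑ j, w i j * f j = ∑ i, m i * f i := by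
    rw [sum_comm]
    exact sum_congr rfl fun j _ => by rw [← sum_mul, hcol]
  have h₃ : ∑ i, ∑ j, w i j * c = c * ∑ i, m i := by
    simp_rw [← sum_mul, hrow, mul_comm]
  simp only [mul_sub, mul_add, sum_sub_distrib, sum_add_distrib, h₁, h₂, h₃]
  ring

/-- Zero-error condition 2 (equality case of Bapat's inequality): if
`b_{ij} = λ₀ a_{ij} β_i / β_j` and the product condition
`∏ b_{ij}^{a_{ij} x_i y_j} = ∏ a_{ij}^{a_{ij} x_i y_j}` holds, then `λ₀ = 1`
and `z = β ∘ y` is a positive eigenvector of `B` with eigenvalue `r`. -/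
theorem stmt_1 (s : ℕ) (hs : 1 ≤ s) (A : Matrix (Fin s) (Fin s) ℝ)
    (hA : ∀ i j, 0 < A i j)
    (r : ℝ) (hr : 0 < r)
    (x y : Fin s → ℝ) (hx : ∀ i, 0 < x i) (hy : ∀ i, 0 < y i)
    (hleft : ∀ j, ∑ i, x i * A i j = r * x j)
    (hright : ∀ i, ∑ j, A i j * y j = r * y i)
    (hnorm : ∑ i, x i * y i = 1)
    (β : Fin s → ℝ) (hβ : ∀ i, 0 < β i)
    (lam₀ : ℝ) (hlam₀ : 0 < lam₀)
    (B : Matrix (Fin s) (Fin s) ℝ)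
    (hB : ∀ i j, B i j = lam₀ * A i j * β i / β j)
    (hprod : ∏ i, ∏ j, (B i j) ^ (A i j * x i * y j)
      = ∏ i, ∏ j, (A i j) ^ (A i j * x i * y j))
    (z : Fin s → ℝ) (hz : ∀ i, z i = β i * y i) :
    lam₀ = 1 ∧ (∀ i, 0 < z i) ∧ (∀ i, ∑ j, B i j * z j = r * z i) ∧
      (∃ v : Fin s → ℝ, v ≠ 0 ∧ B.mulVec v = r • v) := by
  have hBpos : ∀ i j, 0 < B i j := fun i j => by
    rw [hB]
    have := hA i j
    have := hβ i
    have := hβ j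
    positivity
  have hrow : ∀ i, ∑ j, A i j * x i * y j = r * (x i * y i) := fun i => by
    rw [show r * (x i * y i) = x i * (r * y i) by ring, ← hright i, mul_sum]
    exact sum_congr rfl fun j _ => by ring
  have hcol : ∀ j, ∑ i, A i j * x i * y j = r * (x j * y j) := fun j => by
    rw [← mul_assoc, ← hleft j, sum_mul]
    exact sum_congr rfl fun i _ => by ring
  have hlogB : ∀ i j, Real.log (B i j) =
      Real.log (A i j) + (Real.log lam₀ + Real.log (β i) - Real.log (β j)) := fun i j => by
    have ha := (hA i j).ne'
    have hl := hlam₀.ne'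
    have hi := (hβ i).ne'
    rw [hB, Real.log_div (by positivity) (hβ j).ne', Real.log_mul (by positivity) hi,
      Real.log_mul hl ha]
    ring
  have hlog := congrArg Real.log hprod
  rw [log_prod_prod_rpow _ _ hBpos, log_prod_prod_rpow _ _ hA] at hlog
  simp only [hlogB, mul_add (_ * _ * _) (Real.log (A _ _)), sum_add_distrib] at hlog
  rw [sum_sum_mul_const_add_sub _ _ (fun i => Real.log (β i)) _ hrow hcol, ← mul_sum, hnorm,
    mul_one, add_eq_left, mul_eq_zero] at hlog
  have hlam : lam₀ = 1 := Real.eq_one_of_pos_of_log_eq_zero hlam₀ (hlog.resolve_right hr.ne')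
  have hzpos : ∀ i, 0 < z i := fun i => by
    rw [hz]
    exact mul_pos (hβ i) (hy i)
  have heig : ∀ i, ∑ j, B i j * z j = r * z i := fun i => by
    rw [hz, show r * (β i * y i) = β i * (r * y i) by ring, ← hright i, mul_sum]
    refine sum_congr rfl fun j _ => ?_
    have := (hβ j).ne'
    rw [hB, hz, hlam]
    field_simp
  refine ⟨hlam, hzpos, heig, z, fun h => ?_, funext heig⟩
  exact (hzpos ⟨0, hs⟩).ne' (congrFun h _)
end

section
/- Let s ≥ 1 and let A be an s×s real matrix with strictly positive entries a_{ij}. Assume r > 0 and x, y ∈ ℝ^s are entrywise positive vectors with ∑_i x_i a_{ij} = r x_j for all j, ∑_j a_{ij} y_j = r y_i for all i, and ∑_i x_i y_i = 1. Let B be an s×s real matrix with strictly positive entries b_{ij} such that b_{ii} = a_{ii} for all i. Then r · ∏_{i≠j} (b_{ij}/a_{ij})^{a_{ij} x_i y_j / r} ≥ r − ∑_{i≠j} a_{ij} x_i y_j · ln(a_{ij}/b_{ij}). -/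
open Finset

/-- A weighted product of powers `(b / a) ^ (w / r)`, scaled by `r`, dominates its linearization
`r - ∑ w log (a / b)`. -/
theorem sub_sum_mul_log_le_mul_prod_rpow {ι : Type*} (t : Finset ι) {r : ℝ} (hr : 0 < r)
    {a b : ι → ℝ} (w : ι → ℝ) (ha : ∀ i ∈ t, 0 < a i) (hb : ∀ i ∈ t, 0 < b i) :
    r - ∑ i ∈ t, w i * Real.log (a i / b i) ≤ r * ∏ i ∈ t, (b i / a i) ^ (w i / r) := by
  have hprod : ∏ i ∈ t, (b i / a i) ^ (w i / r)
      = Real.exp (-(∑ i ∈ t, w i * Real.log (a i / b i)) / r) := by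
    rw [← Finset.sum_neg_distrib, Finset.sum_div, Real.exp_sum]
    refine Finset.prod_congr rfl fun i hi => ?_
    rw [Real.rpow_def_of_pos (div_pos (hb i hi) (ha i hi)), ← inv_div (a i), Real.log_inv]
    ring_nf
  rw [hprod]
  calc r - ∑ i ∈ t, w i * Real.log (a i / b i)
      = r * (-(∑ i ∈ t, w i * Real.log (a i / b i)) / r + 1) := by
        field_simp
        ring
    _ ≤ _ := mul_le_mul_of_nonneg_left (Real.add_one_le_exp _) hr.le

/-- When `B` agrees with `A` on the diagonal, the Bapat-type geometric-mean
lower bound on `r(B)` dominates the Lindqvist bound: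
`r · ∏_{i≠j} (b_{ij}/a_{ij})^{a_{ij} x_i y_j / r}
  ≥ r − ∑_{i≠j} a_{ij} x_i y_j ln(a_{ij}/b_{ij})`. -/
theorem stmt_3 (s : ℕ) (hs : 1 ≤ s) (A : Matrix (Fin s) (Fin s) ℝ)
    (hA : ∀ i j, 0 < A i j)
    (r : ℝ) (hr : 0 < r)
    (x y : Fin s → ℝ) (hx : ∀ i, 0 < x i) (hy : ∀ i, 0 < y i)
    (hleft : ∀ j, ∑ i, x i * A i j = r * x j)
    (hright : ∀ i, ∑ j, A i j * y j = r * y i)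
    (hnorm : ∑ i, x i * y i = 1)
    (B : Matrix (Fin s) (Fin s) ℝ) (hB : ∀ i j, 0 < B i j)
    (hdiag : ∀ i, B i i = A i i) :
    r * ∏ p ∈ Finset.univ.filter (fun p : Fin s × Fin s => p.1 ≠ p.2),
        (B p.1 p.2 / A p.1 p.2) ^ (A p.1 p.2 * x p.1 * y p.2 / r)
      ≥ r - ∑ p ∈ Finset.univ.filter (fun p : Fin s × Fin s => p.1 ≠ p.2),
        A p.1 p.2 * x p.1 * y p.2 * Real.log (A p.1 p.2 / B p.1 p.2) := by
  exact sub_sum_mul_log_le_mul_prod_rpow _ hr (a := fun p : Fin s × Fin s => A p.1 p.2)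
    (b := fun p => B p.1 p.2) (fun p => A p.1 p.2 * x p.1 * y p.2)
    (fun p _ => hA p.1 p.2) (fun p _ => hB p.1 p.2)
end

section
/- Let s ≥ 1 and let A be an s×s real matrix with strictly positive entries a_{ij}. Assume r > 0 and x, y ∈ ℝ^s are entrywise positive vectors with ∑_i x_i a_{ij} = r x_j for all j, ∑_j a_{ij} y_j = r y_i for all i, and ∑_i x_i y_i = 1. Let B be an s×s real matrix with b_{ij} = a_{ij} for all i ≠ j and b_{ii} > 0 for all i. Then r · ∏_{i=1}^s (b_{ii}/a_{ii})^{a_{ii} x_i y_i / r} ≤ r − ∑_{i=1}^s x_i y_i (a_{ii} − b_{ii}); in particular, since the left-hand side is strictly positive, r > ∑_{i=1}^s x_i y_i (a_{ii} − b_{ii}). -/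
open Finset

/-- Weighted AM-GM with weights of total mass at most one, the missing mass being put at `1`. -/
theorem prod_rpow_le_one_add_sum_mul_sub_one {ι : Type*} [Fintype ι] (w z : ι → ℝ)
    (hw : ∀ i, 0 ≤ w i) (hw_sum : ∑ i, w i ≤ 1) (hz : ∀ i, 0 ≤ z i) :
    ∏ i, z i ^ w i ≤ 1 + ∑ i, w i * (z i - 1) := by
  have h := Real.geom_mean_le_arith_mean_weighted univ
    (fun o : Option ι => o.elim (1 - ∑ i, w i) w) (fun o => o.elim 1 z)
    (by rintro (_ | i) - <;> simp [hw, hw_sum]) (by simp [Fintype.sum_option])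
    (by rintro (_ | i) - <;> simp [hz])
  simp only [Fintype.prod_option, Fintype.sum_option, Option.elim, Real.one_rpow, one_mul,
    mul_one] at h
  simp only [mul_sub, mul_one, sum_sub_distrib]
  linarith

/-- When `A` and `B` differ only on the diagonal (with positive diagonal for `B`),
the Bapat-type geometric-mean lower bound is at most the Lindqvist bound:
`r · ∏_i (b_{ii}/a_{ii})^{a_{ii} x_i y_i / r} ≤ r − ∑_i x_i y_i (a_{ii} − b_{ii})`;
in particular `r > ∑_i x_i y_i (a_{ii} − b_{ii})`. -/
theorem stmt_4 (s : ℕ) (hs : 1 ≤ s) (A : Matrix (Fin s) (Fin s) ℝ)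
    (hA : ∀ i j, 0 < A i j)
    (r : ℝ) (hr : 0 < r)
    (x y : Fin s → ℝ) (hx : ∀ i, 0 < x i) (hy : ∀ i, 0 < y i)
    (hleft : ∀ j, ∑ i, x i * A i j = r * x j)
    (hright : ∀ i, ∑ j, A i j * y j = r * y i)
    (hnorm : ∑ i, x i * y i = 1)
    (B : Matrix (Fin s) (Fin s) ℝ)
    (hoff : ∀ i j, i ≠ j → B i j = A i j)
    (hdiag : ∀ i, 0 < B i i) :
    r * ∏ i, (B i i / A i i) ^ (A i i * x i * y i / r)
        ≤ r - ∑ i, x i * y i * (A i i - B i i) ∧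
      r > ∑ i, x i * y i * (A i i - B i i) := by
  have hw_le (i : Fin s) : A i i * x i * y i / r ≤ x i * y i := by
    have h : A i i * y i ≤ r * y i := by
      rw [← hright i]
      exact single_le_sum (f := fun j => A i j * y j)
        (fun j _ => (mul_pos (hA i j) (hy j)).le) (mem_univ i)
    rw [div_le_iff₀ hr]
    nlinarith [mul_le_mul_of_nonneg_left h (hx i).le]
  have hprod := prod_rpow_le_one_add_sum_mul_sub_one
    (fun i => A i i * x i * y i / r) (fun i => B i i / A i i)
    (fun i => (div_pos (mul_pos (mul_pos (hA i i) (hx i)) (hy i)) hr).le)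
    ((sum_le_sum fun i _ => hw_le i).trans hnorm.le)
    (fun i => (div_pos (hdiag i) (hA i i)).le)
  have hsum : r * (1 + ∑ i, A i i * x i * y i / r * (B i i / A i i - 1))
      = r - ∑ i, x i * y i * (A i i - B i i) := by
    rw [mul_add, mul_one, mul_sum, sub_eq_add_neg, ← sum_neg_distrib]
    congr 1
    refine sum_congr rfl fun i _ => ?_
    have hAi := (hA i i).ne'
    field_simp
    ring
  have hle := (mul_le_mul_of_nonneg_left hprod hr.le).trans_eq hsum
  refine ⟨hle, ?_⟩
  have hpos : 0 < r * ∏ i, (B i i / A i i) ^ (A i i * x i * y i / r) :=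
    mul_pos hr (prod_pos fun i _ => Real.rpow_pos_of_pos (div_pos (hdiag i) (hA i i)) _)
  exact sub_pos.mp (hpos.trans_le hle)
end

section
/- For v ∈ ℝ^s set ‖v‖ = ∑_i |v_i|, and for an s×s real matrix M let ‖M‖ denote the induced operator norm ‖M‖ = sup_{v≠0} ‖Mv‖/‖v‖. Let A and B be s×s real matrices, λ, μ ∈ ℝ, let x ∈ ℝ^s be entrywise positive with Aᵀx = λx and ∑_i x_i = 1, and let y ∈ ℝ^s be entrywise nonnegative with By = μy and ∑_i y_i = 1. Set α = max_i (1/x_i). Then λ − μ ≤ α · ‖A − B‖. -/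
open Finset

/-- Linear form of the operator-norm error bound: if `x` is the ℓ¹-normalized
positive left Perron eigenvector of `A` with eigenvalue `λ`, `y` a nonnegative
ℓ¹-normalized eigenvector of `B` with eigenvalue `μ`, `α = max_i 1/x_i`, and
`N` is the ℓ¹-induced operator norm of `A − B`, then `λ − μ ≤ α · N`. -/
theorem stmt_6 (s : ℕ) (A B : Matrix (Fin s) (Fin s) ℝ)
    (lam mu : ℝ) (x y : Fin s → ℝ)
    (hxpos : ∀ i, 0 < x i)
    (hx : A.transpose.mulVec x = lam • x)
    (hxnorm : ∑ i, x i = 1)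
    (hynonneg : ∀ i, 0 ≤ y i)
    (hy : B.mulVec y = mu • y)
    (hynorm : ∑ i, y i = 1)
    (α : ℝ) (hα : IsGreatest (Set.range fun i => 1 / x i) α)
    (N : ℝ)
    (hN : IsLUB {t : ℝ | ∃ v : Fin s → ℝ, v ≠ 0 ∧
      t = (∑ i, |((A - B).mulVec v) i|) / (∑ i, |v i|)} N) :
    lam - mu ≤ α * N := by
  have hy0 : y ≠ 0 := by
    rintro rfl
    simp at hynorm
  have hyabs : ∑ i, |y i| = 1 := by
    rw [← hynorm]
    exact sum_congr rfl fun i _ => abs_of_nonneg (hynonneg i)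
  have hsum : ∑ i, |((A - B).mulVec y) i| ≤ N :=
    hN.1 ⟨y, hy0, by rw [hyabs, div_one]⟩
  have hN0 : 0 ≤ N := (sum_nonneg fun i _ => abs_nonneg _).trans hsum
  have hα0 : 0 < α := by
    obtain ⟨i, rfl⟩ := hα.1
    exact one_div_pos.mpr (hxpos i)
  have hx1 : ∀ i, x i ≤ 1 := fun i =>
    hxnorm ▸ single_le_sum (fun j _ => (hxpos j).le) (mem_univ i)
  have hαx : ∀ i, 1 ≤ α * x i := fun i =>
    (div_le_iff₀ (hxpos i)).mp (hα.2 ⟨i, rfl⟩)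
  have hpair : 1 ≤ α * (x ⬝ᵥ y) := by
    rw [← hynorm, dotProduct, mul_sum]
    refine sum_le_sum fun i _ => ?_
    nlinarith [mul_le_mul_of_nonneg_right (hαx i) (hynonneg i)]
  have hident : (lam - mu) * (x ⬝ᵥ y) = x ⬝ᵥ (A - B).mulVec y := by
    rw [Matrix.sub_mulVec, dotProduct_sub, hy, Matrix.dotProduct_mulVec,
      ← Matrix.mulVec_transpose, hx, smul_dotProduct, dotProduct_smul,
      smul_eq_mul, smul_eq_mul, sub_mul]
  have hbound : x ⬝ᵥ (A - B).mulVec y ≤ N := by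
    refine le_trans (sum_le_sum fun i _ => ?_) hsum
    calc x i * ((A - B).mulVec y) i
        ≤ x i * |((A - B).mulVec y) i| :=
          mul_le_mul_of_nonneg_left (le_abs_self _) (hxpos i).le
      _ ≤ |((A - B).mulVec y) i| := mul_le_of_le_one_left (abs_nonneg _) (hx1 i)
  rcases le_total (lam - mu) 0 with h | h
  · exact h.trans (mul_nonneg hα0.le hN0)
  · calc lam - mu ≤ (lam - mu) * (α * (x ⬝ᵥ y)) := le_mul_of_one_le_right h hpair
      _ = α * ((lam - mu) * (x ⬝ᵥ y)) := by ring
      _ ≤ α * N := mul_le_mul_of_nonneg_left (hident ▸ hbound) hα0.le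
end

section
/- For v ∈ ℝ^s set ‖v‖ = ∑_i |v_i|, and for an s×s real matrix M let ‖M‖ denote the induced operator norm ‖M‖ = sup_{v≠0} ‖Mv‖/‖v‖. Let A and B be s×s real matrices, λ > μ > 0 real numbers, let x ∈ ℝ^s be entrywise positive with Aᵀx = λx and ∑_i x_i = 1, and let y ∈ ℝ^s be entrywise nonnegative with By = μy and ∑_i y_i = 1. Set α = max_i (1/x_i). Then ln(λ/μ) ≤ ln(1 + α·‖A − B‖/μ). -/
open Finset

/-- The operator-norm error bound (inequality (invert)):
`ln(λ/μ) ≤ ln(1 + α‖A − B‖/μ)` where `α = max_i 1/x_i`, `x` the ℓ¹-normalized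
positive left Perron eigenvector of `A` with eigenvalue `λ > μ > 0`, and `y`
a nonnegative ℓ¹-normalized eigenvector of `B` with eigenvalue `μ`. -/
theorem stmt_7 (s : ℕ) (A B : Matrix (Fin s) (Fin s) ℝ)
    (lam mu : ℝ) (hlammu : lam > mu) (hmu : mu > 0)
    (x y : Fin s → ℝ)
    (hxpos : ∀ i, 0 < x i)
    (hx : A.transpose.mulVec x = lam • x)
    (hxnorm : ∑ i, x i = 1)
    (hynonneg : ∀ i, 0 ≤ y i)
    (hy : B.mulVec y = mu • y)
    (hynorm : ∑ i, y i = 1)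
    (α : ℝ) (hα : IsGreatest (Set.range fun i => 1 / x i) α)
    (N : ℝ)
    (hN : IsLUB {t : ℝ | ∃ v : Fin s → ℝ, v ≠ 0 ∧
      t = (∑ i, |((A - B).mulVec v) i|) / (∑ i, |v i|)} N) :
    Real.log (lam / mu) ≤ Real.log (1 + α * N / mu) := by
  have hα_mul : ∀ i, 1 ≤ α * x i := fun i => by
    have h := hα.2 ⟨i, rfl⟩
    exact (div_le_iff₀ (hxpos i)).1 h
  have hαpos : 0 < α := by
    obtain ⟨i, hi⟩ := hα.1
    exact hi ▸ one_div_pos.2 (hxpos i)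
  have hdot : x ⬝ᵥ ((A - B).mulVec y) = (lam - mu) * (x ⬝ᵥ y) := by
    rw [Matrix.sub_mulVec, hy, dotProduct_sub, Matrix.dotProduct_mulVec,
      ← Matrix.mulVec_transpose, hx, smul_dotProduct, dotProduct_smul, smul_eq_mul, smul_eq_mul]
    ring
  have hone : 1 ≤ α * (x ⬝ᵥ y) := by
    rw [dotProduct, mul_sum, ← hynorm]
    refine sum_le_sum fun i _ => ?_
    nlinarith [hα_mul i, hynonneg i]
  have hx_le : ∀ i, x i ≤ 1 := fun i => by
    rw [← hxnorm]
    exact single_le_sum (fun j _ => (hxpos j).le) (mem_univ i)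
  have hy_ne : y ≠ 0 := by
    rintro rfl
    simp at hynorm
  have hN_ge : ∑ i, |((A - B).mulVec y) i| ≤ N := by
    refine hN.1 ⟨y, hy_ne, ?_⟩
    simp_rw [abs_of_nonneg (hynonneg _), hynorm, div_one]
  have hdot_le : x ⬝ᵥ ((A - B).mulVec y) ≤ N := by
    refine le_trans (sum_le_sum fun i _ => ?_) hN_ge
    exact (mul_le_mul_of_nonneg_left (le_abs_self _) (hxpos i).le).trans
      (mul_le_of_le_one_left (abs_nonneg _) (hx_le i))
  have hgap : lam - mu ≤ α * N :=
    calc lam - mu ≤ (lam - mu) * (α * (x ⬝ᵥ y)) :=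
          le_mul_of_one_le_right (sub_nonneg.2 hlammu.le) hone
      _ = α * (x ⬝ᵥ ((A - B).mulVec y)) := by rw [hdot]; ring
      _ ≤ α * N := mul_le_mul_of_nonneg_left hdot_le hαpos.le
  refine Real.log_le_log (div_pos (hmu.trans hlammu) hmu) ?_
  rw [one_add_div hmu.ne']
  exact div_le_div_of_nonneg_right (by linarith) hmu.le
end

section
/- For v ∈ ℝ^s set ‖v‖ = ∑_i |v_i|, and for an s×s real matrix M let ‖M‖ denote the induced operator norm ‖M‖ = sup_{v≠0} ‖Mv‖/‖v‖. Let A be an s×s real matrix with nonnegative entries such that every column sum of A equals λ, i.e., ∑_i a_{ij} = λ for all j. Let B be an s×s real matrix and let y ∈ ℝ^s be entrywise nonnegative with By = μy, ∑_i y_i = 1, and λ > μ > 0. Then ln(λ/μ) ≤ ln(1 + s·‖A − B‖/μ). -/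
open Finset

/-- Corollary for matrices with equal column sums: if every column sum of the
nonnegative matrix `A` equals `λ` and `y` is a nonnegative ℓ¹-normalized
eigenvector of `B` with eigenvalue `μ`, `λ > μ > 0`, then
`ln(λ/μ) ≤ ln(1 + s‖A − B‖/μ)`. -/
theorem stmt_8 (s : ℕ) (A B : Matrix (Fin s) (Fin s) ℝ)
    (hA : ∀ i j, 0 ≤ A i j)
    (lam mu : ℝ)
    (hcol : ∀ j, ∑ i, A i j = lam)
    (y : Fin s → ℝ)
    (hynonneg : ∀ i, 0 ≤ y i)
    (hy : B.mulVec y = mu • y)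
    (hynorm : ∑ i, y i = 1)
    (hlammu : lam > mu) (hmu : mu > 0)
    (N : ℝ)
    (hN : IsLUB {t : ℝ | ∃ v : Fin s → ℝ, v ≠ 0 ∧
      t = (∑ i, |((A - B).mulVec v) i|) / (∑ i, |v i|)} N) :
    Real.log (lam / mu) ≤ Real.log (1 + s * N / mu) := by
  have hs : (1 : ℝ) ≤ s := by
    rcases Nat.eq_zero_or_pos s with rfl | h
    · simp at hynorm
    · exact_mod_cast h
  have hy0 : y ≠ 0 := by
    rintro rfl
    simp at hynorm
  have hcolA : ∑ i, A.mulVec y i = lam := by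
    simp only [Matrix.mulVec, dotProduct]
    rw [Finset.sum_comm]
    simp_rw [← Finset.sum_mul, hcol, ← Finset.mul_sum, hynorm, mul_one]
  have hdiff : ∑ i, (A - B).mulVec y i = lam - mu := by
    simp [Matrix.sub_mulVec, hy, Finset.sum_sub_distrib, hcolA, ← Finset.mul_sum, hynorm]
  have hbound : ∑ i, |(A - B).mulVec y i| ≤ N := by
    have h := hN.1 ⟨y, hy0, rfl⟩
    simpa only [abs_of_nonneg (hynonneg _), hynorm, div_one] using h
  have hgap : lam - mu ≤ N :=
    hdiff ▸ (Finset.sum_le_sum fun i _ => le_abs_self _).trans hbound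
  refine Real.log_le_log (div_pos (hmu.trans hlammu) hmu) ?_
  rw [div_le_iff₀ hmu, add_mul, div_mul_cancel₀ _ hmu.ne']
  nlinarith
end
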